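/- For all p, q ≥ 0 and all x ≥ 0, (q−p)∫₀ˣ 𝕎^{(p)}(x−y) W^{(q)}(y) dy = W^{(q)}(x) − 𝕎^{(p)}(x) + α ( W^{(q)}(0) 𝕎^{(p)}(x) + ∫₀ˣ 𝕎^{(p)}(x−y) W^{(q)′}(y) dy ). -/

import Mathlib

open MeasureTheory Set Filter Topology

/-- The Laplace exponent of a spectrally negative Lévy process with triplet `(γ, σ, ν)`. -/
noncomputable def levyPsi (γ σ : ℝ) (ν : Measure ℝ) (l : ℝ) : ℝ :=
  γ * l + σ ^ 2 / 2 * l ^ 2 +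
    ∫ z in Set.Ioi (0 : ℝ),
      (Real.exp (-l * z) - 1 +
        l * z * Set.indicator (Set.Ioc (0 : ℝ) 1) (fun _ => (1 : ℝ)) z) ∂ν

/-- The right-inverse `Φ(q) = sup {λ ≥ 0 : f(λ) = q}` of a Laplace exponent `f`. -/
noncomputable def levyPhi (f : ℝ → ℝ) (q : ℝ) : ℝ :=
  sSup {l : ℝ | 0 ≤ l ∧ f l = q}

/-- `∫₀¹ z ν(dz)`, as an extended nonnegative real. -/
noncomputable def smallJumpMass (ν : Measure ℝ) : ENNReal :=
  ∫⁻ z in Set.Ioc (0 : ℝ) 1, ENNReal.ofReal z ∂ν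

/-- `ν` is a Lévy measure on `(0,∞)`: it charges only `(0,∞)` and
integrates `min(1, z²)`. -/
def IsLevyMeasure (ν : Measure ℝ) : Prop :=
  ν (Set.Iic 0) = 0 ∧ (∫⁻ z in Set.Ioi (0 : ℝ), ENNReal.ofReal (min 1 (z ^ 2)) ∂ν) ≠ ⊤

/-- The process is not the negative of a subordinator: `σ > 0`, or
`∫₀¹ z ν(dz) = ∞`, or `γ + ∫₀¹ z ν(dz) > 0`. -/
def NonDegenerate (γ σ : ℝ) (ν : Measure ℝ) : Prop :=
  0 < σ ∨ smallJumpMass ν = ⊤ ∨ 0 < γ + (smallJumpMass ν).toReal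

/-- `W` is the `q`-scale function associated with the Laplace exponent `f`,
where `Φq` is the value of the right-inverse of `f` at `q`. -/
def IsScaleFunction (f : ℝ → ℝ) (Φq q : ℝ) (W : ℝ → ℝ) : Prop :=
  (∀ x < 0, W x = 0) ∧ ContinuousOn W (Set.Ici 0) ∧ MonotoneOn W (Set.Ici 0) ∧
    ∀ l, Φq < l → (∫ y in Set.Ioi (0 : ℝ), Real.exp (-l * y) * W y) = 1 / (f l - q)

/-- Admissibility of the refraction parameter `α`: `α > 0`, and when the paths
have bounded variation (`σ = 0` and `∫₀¹ z ν(dz) < ∞`), `α` is smaller than the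
drift `c = γ + ∫₀¹ z ν(dz)`. -/
def AlphaAdmissible (γ σ α : ℝ) (ν : Measure ℝ) : Prop :=
  0 < α ∧ ((σ = 0 ∧ smallJumpMass ν ≠ ⊤) → α < γ + (smallJumpMass ν).toReal)

theorem eqOn_zero_of_laplace_eq_zero {F : ℝ → ℝ} {l : ℝ} (hF : ContinuousOn F (Ici 0))
    (hint : IntegrableOn (fun y => Real.exp (-l * y) * F y) (Ioi 0))
    (hzero : ∀ n : ℕ, ∫ y in Ioi (0 : ℝ), Real.exp (-(l + n) * y) * F y = 0) :
    EqOn F 0 (Ici 0) := by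
  set h : ℝ → ℝ := fun y => Real.exp (-l * y) * F y with hh
  have hpow_int : ∀ n : ℕ, IntegrableOn (fun y => Real.exp (-y) ^ n * h y) (Ioi 0) := by
    intro n
    refine Integrable.bdd_mul (c := 1) hint
      (Continuous.aestronglyMeasurable (by fun_prop)) ?_
    filter_upwards [ae_restrict_mem measurableSet_Ioi] with y hy
    rw [Real.norm_of_nonneg (by positivity)]
    exact pow_le_one₀ (Real.exp_nonneg _) (Real.exp_le_one_iff.2 (neg_nonpos.2 (le_of_lt hy)))
  have hpow : ∀ n : ℕ, ∫ y in Ioi (0 : ℝ), Real.exp (-y) ^ n * h y = 0 := by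
    intro n
    refine Eq.trans ?_ (hzero n)
    refine setIntegral_congr_fun measurableSet_Ioi fun y _ => ?_
    simp only [hh, ← Real.exp_nat_mul, ← mul_assoc, ← Real.exp_add]
    ring_nf
  have hpoly_int : ∀ P : Polynomial ℝ,
      IntegrableOn (fun y => P.eval (Real.exp (-y)) * h y) (Ioi 0) := by
    intro P
    simp only [Polynomial.eval_eq_sum_range, Finset.sum_mul, mul_assoc]
    exact integrable_finsetSum _ fun n _ => (hpow_int n).const_mul _
  have hpoly : ∀ P : Polynomial ℝ,
      ∫ y in Ioi (0 : ℝ), P.eval (Real.exp (-y)) * h y = 0 := by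
    intro P
    simp only [Polynomial.eval_eq_sum_range, Finset.sum_mul, mul_assoc]
    rw [integral_finsetSum _ fun n _ => (hpow_int n).const_mul _]
    simp [integral_const_mul, hpow]
  have htest : ∀ g : ℝ → ℝ, Continuous g → HasCompactSupport g → tsupport g ⊆ Ioi 0 →
      ∫ y in Ioi (0 : ℝ), g y * h y = 0 := by
    intro g hg hgc hgs
    have hG : Continuous fun u => g (-Real.log u) := by
      rw [continuous_iff_continuousAt]
      intro u
      rcases eq_or_ne u 0 with rfl | hu
      · have h0 : g 0 = 0 := image_eq_zero_of_notMem_tsupport fun h => lt_irrefl (0 : ℝ) (hgs h)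
        have h1 : ∀ᶠ u in 𝓝[≠] (0 : ℝ), g (-Real.log u) = 0 := by
          have h2 := tendsto_neg_atBot_atTop.comp Real.tendsto_log_nhdsNE_zero
          have h3 : ∀ᶠ t : ℝ in atTop, g t = 0 := by
            have := hgc.isBounded.bddAbove
            obtain ⟨M, hM⟩ := this
            filter_upwards [eventually_gt_atTop M] with t ht
            exact image_eq_zero_of_notMem_tsupport fun h => absurd (hM h) (not_le.2 ht)
          exact h2.eventually h3
        rw [continuousAt_iff_punctured_nhds]
        simp only [Real.log_zero, neg_zero, h0]
        exact tendsto_const_nhds.congr' (h1.mono fun _ h => h.symm)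
      · exact hg.continuousAt.comp (Real.continuousAt_log hu).neg
    have hgb : ∃ C, ∀ y, ‖g y‖ ≤ C := hgc.exists_bound_of_continuous hg
    obtain ⟨C, hC⟩ := hgb
    have hgint : IntegrableOn (fun y => g y * h y) (Ioi 0) :=
      hint.bdd_mul hg.aestronglyMeasurable (Eventually.of_forall hC)
    set K := ∫ y in Ioi (0 : ℝ), ‖h y‖ with hK
    have hK0 : 0 ≤ K := integral_nonneg fun _ => norm_nonneg _
    refine norm_le_zero_iff.1 (le_of_forall_pos_le_add fun ε hε => ?_)
    obtain ⟨P, hP⟩ := exists_polynomial_near_of_continuousOn 0 1 _ hG.continuousOn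
      (ε / (K + 1)) (by positivity)
    have hsub : ∫ y in Ioi (0 : ℝ), g y * h y =
        ∫ y in Ioi (0 : ℝ), (g y - P.eval (Real.exp (-y))) * h y := by
      simp only [sub_mul]
      rw [integral_sub hgint (hpoly_int P), hpoly, sub_zero]
    rw [hsub, zero_add]
    calc _ ≤ ∫ y in Ioi (0 : ℝ), ε / (K + 1) * ‖h y‖ := by
          refine norm_integral_le_of_norm_le (hint.norm.const_mul _) ?_
          filter_upwards [ae_restrict_mem measurableSet_Ioi] with y hy
          have := hP (Real.exp (-y)) ⟨(Real.exp_pos _).le,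
            Real.exp_le_one_iff.2 (neg_nonpos.2 (le_of_lt hy))⟩
          rw [Real.log_exp, neg_neg, abs_sub_comm] at this
          rw [norm_mul]
          exact mul_le_mul_of_nonneg_right this.le (norm_nonneg _)
      _ = ε / (K + 1) * K := by rw [integral_const_mul]
      _ ≤ ε := by
          rw [div_mul_eq_mul_div, div_le_iff₀ (by positivity)]
          nlinarith
  have hae : ∀ᵐ y, y ∈ Ioi (0 : ℝ) → h y = 0 := by
    refine isOpen_Ioi.ae_eq_zero_of_integral_contDiff_smul_eq_zero
      hint.locallyIntegrableOn fun g hg hgc hgs => ?_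
    rw [← htest g hg.continuous hgc hgs, eq_comm]
    refine setIntegral_eq_integral_of_forall_compl_eq_zero fun y hy => ?_
    rw [image_eq_zero_of_notMem_tsupport fun h => hy (hgs h), zero_mul]
  refine Measure.eqOn_of_ae_eq (μ := volume) ?_ hF continuousOn_const (by simp)
  rw [← restrict_Ioi_eq_restrict_Ici, EventuallyEq, ae_restrict_iff' measurableSet_Ioi]
  filter_upwards [hae] with y hy hy0
  simpa [hh, Real.exp_ne_zero] using hy hy0

theorem laplace_convolution {A k : ℝ → ℝ} {l : ℝ}
    (hA : IntegrableOn (fun y => Real.exp (-l * y) * A y) (Ioi 0))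
    (hk : IntegrableOn (fun y => Real.exp (-l * y) * k y) (Ioi 0)) :
    IntegrableOn (fun x => Real.exp (-l * x) * ∫ y in (0 : ℝ)..x, A (x - y) * k y) (Ioi 0) ∧
      ∫ x in Ioi (0 : ℝ), Real.exp (-l * x) * ∫ y in (0 : ℝ)..x, A (x - y) * k y =
        (∫ y in Ioi (0 : ℝ), Real.exp (-l * y) * A y) *
          ∫ y in Ioi (0 : ℝ), Real.exp (-l * y) * k y := by
  have key : ∀ x : ℝ, Real.exp (-l * x) * ∫ y in (0 : ℝ)..x, A (x - y) * k y =
      ∫ y in (0 : ℝ)..x, ContinuousLinearMap.mul ℝ ℝ (Real.exp (-l * y) * k y)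
        (Real.exp (-l * (x - y)) * A (x - y)) := by
    intro x
    rw [← intervalIntegral.integral_const_mul]
    refine intervalIntegral.integral_congr fun y _ => ?_
    have : Real.exp (-l * x) = Real.exp (-l * y) * Real.exp (-l * (x - y)) := by
      rw [← Real.exp_add]; ring_nf
    simp only [ContinuousLinearMap.mul_apply', this]
    ring
  simp only [key]
  constructor
  · rw [← integrable_indicator_iff measurableSet_Ioi]
    exact integrable_posConvolution hk hA (ContinuousLinearMap.mul ℝ ℝ)
  · rw [integral_posConvolution hk hA (ContinuousLinearMap.mul ℝ ℝ),
      ContinuousLinearMap.mul_apply', mul_comm]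

theorem continuousOn_convolution {A k : ℝ → ℝ} (hA0 : ∀ x < 0, A x = 0)
    (hA : ContinuousOn A (Ici 0)) (hk : ∀ R, IntegrableOn k (Ioc 0 R)) :
    ContinuousOn (fun x => ∫ y in (0 : ℝ)..x, A (x - y) * k y) (Ici 0) := by
  have hAm : Measurable A := by
    refine measurable_of_restrict_of_restrict_compl (measurableSet_Ici (a := (0 : ℝ)))
      (continuousOn_iff_continuous_domRestrict.1 hA).measurable ?_
    have : (Ici (0 : ℝ))ᶜ.domRestrict A = fun _ => 0 := by
      ext x
      exact hA0 x (not_le.1 x.2)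
    rw [this]
    exact measurable_const
  intro x₀ hx₀
  have hx₀ : 0 ≤ x₀ := hx₀
  set R := x₀ + 1 with hR
  have hR0 : 0 ≤ R := by positivity
  obtain ⟨C, hC⟩ := (isCompact_Icc (a := (0 : ℝ)) (b := R)).exists_bound_of_continuousOn
    (hA.mono Icc_subset_Ici_self)
  have hC0 : 0 ≤ C := (norm_nonneg _).trans (hC 0 ⟨le_rfl, hR0⟩)
  have hAat : ∀ u : ℝ, u ≠ 0 → ContinuousAt A u := by
    intro u hu
    rcases lt_or_gt_of_ne hu with h | h
    · exact continuousAt_const.congr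
        ((eventually_lt_nhds h).mono fun v hv => (hA0 v hv).symm)
    · exact hA.continuousAt (Ici_mem_nhds h)
  have hcont : ContinuousAt (fun x => ∫ y in (0 : ℝ)..R, A (x - y) * k y) x₀ := by
    refine intervalIntegral.continuousAt_of_dominated_interval (bound := fun y => C * ‖k y‖)
      ?_ ?_ ?_ ?_
    · refine Eventually.of_forall fun x => ?_
      rw [uIoc_of_le hR0]
      exact (hAm.comp (measurable_const.sub measurable_id)).aestronglyMeasurable.mul
        (hk R).aestronglyMeasurable
    · filter_upwards [eventually_lt_nhds (show x₀ < R by linarith)] with x hx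
      refine Eventually.of_forall fun y hy => ?_
      rw [uIoc_of_le hR0] at hy
      rw [norm_mul]
      refine mul_le_mul_of_nonneg_right ?_ (norm_nonneg _)
      rcases lt_or_ge (x - y) 0 with h | h
      · rw [hA0 _ h, norm_zero]
        exact hC0
      · exact hC _ ⟨h, by linarith [hy.1]⟩
    · rw [intervalIntegrable_iff_integrableOn_Ioc_of_le hR0]
      exact (hk R).norm.const_mul C
    · have : ∀ᵐ y : ℝ, y ≠ x₀ := by simp [ae_iff]
      filter_upwards [this] with y hy _
      have h : ContinuousAt A (x₀ - y) := hAat _ (sub_ne_zero.2 hy.symm)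
      exact (ContinuousAt.comp (f := fun x => x - y) h (by fun_prop)).mul continuousAt_const
  refine hcont.continuousWithinAt.congr_of_eventuallyEq ?_ ?_
  all_goals
    have hEq : ∀ x : ℝ, 0 ≤ x → x < R →
        ∫ y in (0 : ℝ)..x, A (x - y) * k y = ∫ y in (0 : ℝ)..R, A (x - y) * k y := by
      intro x hx hxR
      rw [intervalIntegral.integral_of_le hx, intervalIntegral.integral_of_le hR0]
      refine (setIntegral_eq_of_subset_of_forall_sdiff_eq_zero measurableSet_Ioc
        (Ioc_subset_Ioc_right hxR.le) fun y hy => ?_).symm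
      have : x < y := not_le.1 fun h => hy.2 ⟨hy.1.1, h⟩
      rw [hA0 _ (by linarith), zero_mul]
  · filter_upwards [self_mem_nhdsWithin,
      mem_nhdsWithin_of_mem_nhds (eventually_lt_nhds (show x₀ < R by linarith))] with x hx hxR
    exact hEq x hx hxR
  · exact hEq x₀ hx₀ (by linarith)

theorem tendsto_exp_mul_of_monotoneOn {W : ℝ → ℝ} {l : ℝ} (hl : 0 < l)
    (hmono : MonotoneOn W (Ici 0))
    (hint : IntegrableOn (fun y => Real.exp (-l * y) * W y) (Ioi 0)) :
    Tendsto (fun y => Real.exp (-l * y) * W y) atTop (𝓝 0) := by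
  have hexp : Tendsto (fun y : ℝ => Real.exp (-l * y)) atTop (𝓝 0) :=
    Real.tendsto_exp_atBot.comp (tendsto_id.const_mul_atTop_of_neg (neg_lt_zero.2 hl))
  have htail : Tendsto (fun y : ℝ => l * ∫ s in Ioi y, Real.exp (-l * s) * W s)
      atTop (𝓝 0) := by
    have h := (intervalIntegral_tendsto_integral_Ioi 0 hint tendsto_id).const_sub
      (∫ s in Ioi (0 : ℝ), Real.exp (-l * s) * W s)
    rw [sub_self] at h
    have h := h.const_mul l
    rw [mul_zero] at h
    refine h.congr' ?_
    filter_upwards [eventually_ge_atTop 0] with y hy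
    rw [id, ← intervalIntegral.integral_Ioi_sub_Ioi hint hy, sub_sub_cancel]
  have hlow : Tendsto (fun y : ℝ => Real.exp (-l * y) * W 0) atTop (𝓝 0) := by
    simpa using hexp.mul_const (W 0)
  refine tendsto_of_tendsto_of_tendsto_of_le_of_le' hlow htail ?_ ?_
  · filter_upwards [eventually_ge_atTop 0] with y hy
    exact mul_le_mul_of_nonneg_left (hmono (mem_Ici.2 le_rfl) hy hy) (Real.exp_nonneg _)
  · filter_upwards [eventually_ge_atTop 0] with y hy
    have h1 : ∫ s in Ioi y, Real.exp (-l * s) * W y ≤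
        ∫ s in Ioi y, Real.exp (-l * s) * W s := by
      refine setIntegral_mono_on ((integrableOn_exp_mul_Ioi (neg_lt_zero.2 hl) y).mul_const _)
        (hint.mono_set (Ioi_subset_Ioi hy)) measurableSet_Ioi fun s hs => ?_
      exact mul_le_mul_of_nonneg_left (hmono hy (hy.trans (le_of_lt hs)) (le_of_lt hs))
        (Real.exp_nonneg _)
    rw [integral_mul_const, integral_exp_mul_Ioi (neg_lt_zero.2 hl)] at h1
    calc Real.exp (-l * y) * W y = l * (-Real.exp (-l * y) / -l * W y) := by field_simp
      _ ≤ _ := mul_le_mul_of_nonneg_left h1 hl.le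

theorem laplace_deriv {W W' : ℝ → ℝ} {l : ℝ} (hl : 0 < l)
    (hcont : ContinuousOn W (Ici 0)) (hmono : MonotoneOn W (Ici 0))
    (hderiv : ∀ y : ℝ, 0 < y → HasDerivAt W (W' y) y)
    (hint : IntegrableOn (fun y => Real.exp (-l * y) * W y) (Ioi 0)) :
    IntegrableOn (fun y => Real.exp (-l * y) * W' y) (Ioi 0) ∧
      ∫ y in Ioi (0 : ℝ), Real.exp (-l * y) * W' y =
        l * (∫ y in Ioi (0 : ℝ), Real.exp (-l * y) * W y) - W 0 := by
  set e : ℝ → ℝ := fun y => Real.exp (-l * y) * W y with he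
  have hec : ContinuousOn e (Ici 0) := (Continuous.continuousOn (by fun_prop)).mul hcont
  have heI : ∀ y, 0 ≤ y → IntervalIntegrable e volume 0 y := fun y hy =>
    (hec.mono (by rw [uIcc_of_le hy]; exact Icc_subset_Ici_self)).intervalIntegrable
  set H : ℝ → ℝ := fun y => e y + l * ∫ s in (0 : ℝ)..y, e s with hH
  have hHderiv : ∀ y ∈ Ioi (0 : ℝ), HasDerivAt H (Real.exp (-l * y) * W' y) y := by
    intro y hy
    have hy : 0 < y := hy
    have h1 : HasDerivAt (fun y : ℝ => Real.exp (-l * y)) (Real.exp (-l * y) * (-l)) y := by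
      simpa using ((hasDerivAt_id y).const_mul (-l)).exp
    have h2 : HasDerivAt (fun y => ∫ s in (0 : ℝ)..y, e s) (e y) y := by
      refine intervalIntegral.integral_hasDerivAt_right (heI y hy.le) ?_
        (hec.continuousAt (Ici_mem_nhds hy))
      exact (hec.mono Ioi_subset_Ici_self).stronglyMeasurableAtFilter isOpen_Ioi y hy
    refine ((h1.mul (hderiv y hy)).add (h2.const_mul l)).congr_deriv ?_
    simp only [he]
    ring
  have hHcont : ContinuousWithinAt H (Ici 0) 0 := by
    refine (hec 0 (mem_Ici.2 le_rfl)).add (ContinuousWithinAt.mul continuousWithinAt_const ?_)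
    have h : ContinuousOn (fun y => ∫ s in (0 : ℝ)..y, e s) (Icc 0 1) := by
      have := intervalIntegral.continuousOn_primitive_interval (μ := volume) (f := e)
        (a := 0) (b := 1)
        (by
          rw [uIcc_of_le zero_le_one]
          exact (hec.mono Icc_subset_Ici_self).integrableOn_Icc)
      rwa [uIcc_of_le zero_le_one] at this
    exact (h 0 ⟨le_rfl, zero_le_one⟩).mono_of_mem_nhdsWithin (Icc_mem_nhdsGE zero_lt_one)
  have hpos : ∀ y ∈ Ioi (0 : ℝ), 0 ≤ Real.exp (-l * y) * W' y := by
    intro y hy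
    refine mul_nonneg (Real.exp_nonneg _) ?_
    rw [← (hderiv y hy).hasDerivWithinAt.derivWithin
      (uniqueDiffOn_Ici (0 : ℝ) y (Ioi_subset_Ici_self hy))]
    exact hmono.derivWithin_nonneg
  have hlim : Tendsto H atTop (𝓝 (l * ∫ y in Ioi (0 : ℝ), e y)) := by
    simpa only [zero_add, id] using (tendsto_exp_mul_of_monotoneOn hl hmono hint).add
      ((intervalIntegral_tendsto_integral_Ioi 0 hint tendsto_id).const_mul l)
  refine ⟨integrableOn_Ioi_deriv_of_nonneg hHcont hHderiv hpos hlim, ?_⟩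
  rw [integral_Ioi_of_hasDerivAt_of_nonneg hHcont hHderiv hpos hlim]
  simp [hH, he]

theorem setIntegral_smallJumps_eventually_gt {ν : Measure ℝ} {M : ℝ}
    (hint : ∀ l : ℝ, 0 ≤ l →
      IntegrableOn (fun z => Real.exp (-l * z) - 1 + l * z) (Ioc 0 1) ν)
    (hM : smallJumpMass ν = ⊤ ∨ M < (smallJumpMass ν).toReal) :
    ∀ᶠ l : ℝ in atTop,
      M * l < ∫ z in Ioc (0 : ℝ) 1, (Real.exp (-l * z) - 1 + l * z) ∂ν := by
  have hnn : ∀ l z : ℝ, 0 ≤ Real.exp (-l * z) - 1 + l * z := fun l z => by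
    have := Real.add_one_le_exp (-l * z)
    linarith
  rcases lt_or_ge M 0 with hM0 | hM0
  · filter_upwards [eventually_gt_atTop 0] with l hl
    exact (mul_neg_of_neg_of_pos hM0 hl).trans_le (integral_nonneg (hnn l))
  have hlt : ENNReal.ofReal M < smallJumpMass ν := by
    rcases eq_or_ne (smallJumpMass ν) ⊤ with h | h
    · rw [h]
      exact ENNReal.ofReal_lt_top
    · rw [ENNReal.ofReal_lt_iff_lt_toReal hM0 h]
      exact hM.resolve_left h
  have hpt : ∀ z : ℝ, 0 < z → Tendsto (fun l : ℝ => (Real.exp (-l * z) - 1 + l * z) / l)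
      atTop (𝓝 z) := by
    intro z hz
    have hlow : Tendsto (fun l : ℝ => z - l⁻¹) atTop (𝓝 z) := by
      simpa using tendsto_inv_atTop_zero.const_sub z
    refine tendsto_of_tendsto_of_tendsto_of_le_of_le' hlow tendsto_const_nhds ?_ ?_
    · filter_upwards [eventually_gt_atTop 0] with l hl
      rw [le_div_iff₀ hl, sub_mul, inv_mul_cancel₀ hl.ne']
      linarith [Real.exp_pos (-l * z)]
    · filter_upwards [eventually_gt_atTop 0] with l hl
      have : Real.exp (-l * z) ≤ 1 := Real.exp_le_one_iff.2 (by nlinarith)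
      rw [div_le_iff₀ hl]
      linarith
  have hfatou : smallJumpMass ν ≤ liminf (fun l : ℝ => ∫⁻ z in Ioc (0 : ℝ) 1,
      ENNReal.ofReal ((Real.exp (-l * z) - 1 + l * z) / l) ∂ν) atTop := by
    refine le_trans (setLIntegral_mono_ae' measurableSet_Ioc (Eventually.of_forall ?_))
      (lintegral_liminf_le fun l => by fun_prop)
    intro z hz
    exact (ENNReal.tendsto_ofReal (hpt z hz.1)).liminf_eq.ge
  filter_upwards [eventually_lt_of_lt_liminf (hlt.trans_le hfatou), eventually_gt_atTop 0]
    with l hl hl0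
  rw [← ofReal_integral_eq_lintegral_ofReal ((hint l hl0.le).div_const l)
    (Eventually.of_forall fun z => div_nonneg (hnn l z) hl0.le), integral_div,
    ENNReal.ofReal_lt_ofReal_iff_of_nonneg hM0, lt_div_iff₀ hl0] at hl
  exact hl

theorem levyPsi_sub_eventually_gt {γ σ β : ℝ} {ν : Measure ℝ} (hν : IsLevyMeasure ν)
    (h : 0 < σ ∨ smallJumpMass ν = ⊤ ∨ β < γ + (smallJumpMass ν).toReal) (C : ℝ) :
    ∀ᶠ l : ℝ in atTop, C < levyPsi γ σ ν l - β * l := by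
  have hnn : ∀ l z : ℝ, 0 ≤ Real.exp (-l * z) - 1 + l * z := fun l z => by
    have := Real.add_one_le_exp (-l * z)
    linarith
  have hmin : IntegrableOn (fun z : ℝ => min 1 (z ^ 2)) (Ioi 0) ν := by
    refine ⟨Continuous.aestronglyMeasurable (by fun_prop), ?_⟩
    rw [hasFiniteIntegral_iff_ofReal (Eventually.of_forall fun z => by positivity)]
    exact hν.2.lt_top
  have hone : IntegrableOn (fun _ : ℝ => (1 : ℝ)) (Ioi 1) ν := by
    refine (integrableOn_congr_fun (fun z hz => ?_) measurableSet_Ioi).1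
      (hmin.mono_set (Ioi_subset_Ioi zero_le_one))
    have hz : 1 < z := hz
    exact min_eq_left (by nlinarith)
  have hsmall : ∀ l : ℝ, 0 ≤ l →
      IntegrableOn (fun z => Real.exp (-l * z) - 1 + l * z) (Ioc 0 1) ν := by
    intro l hl
    refine Integrable.mono' ((hmin.mono_set Ioc_subset_Ioi_self).const_mul (l ^ 2))
      (Continuous.aestronglyMeasurable (by fun_prop)) ?_
    filter_upwards [ae_restrict_mem measurableSet_Ioc] with z hz
    rw [Real.norm_of_nonneg (hnn l z), min_eq_right (by nlinarith [hz.1, hz.2])]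
    have hlz : 0 ≤ l * z := mul_nonneg hl hz.1.le
    have h1 : Real.exp (-l * z) * (1 + l * z) ≤ 1 := by
      have h2 := Real.add_one_le_exp (l * z)
      have h3 : Real.exp (-l * z) * Real.exp (l * z) = 1 := by
        rw [← Real.exp_add]; simp
      nlinarith [Real.exp_pos (-l * z)]
    have h4 : Real.exp (-l * z) ≤ 1 - l * z + (l * z) ^ 2 := by
      nlinarith [Real.exp_pos (-l * z), pow_nonneg hlz 3, mul_nonneg hlz hlz]
    nlinarith
  set V : ℝ := ∫ _ in Ioi (1 : ℝ), (1 : ℝ) ∂ν with hV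
  set S : ℝ → ℝ := fun l => ∫ z in Ioc (0 : ℝ) 1, (Real.exp (-l * z) - 1 + l * z) ∂ν with hS
  have hS0 : ∀ l, 0 ≤ S l := fun l => integral_nonneg (hnn l)
  have hbound : ∀ l : ℝ, 0 ≤ l →
      γ * l + σ ^ 2 / 2 * l ^ 2 + S l - V ≤ levyPsi γ σ ν l := by
    intro l hl
    set g : ℝ → ℝ := fun z => Real.exp (-l * z) - 1 +
      l * z * indicator (Ioc (0 : ℝ) 1) (fun _ => (1 : ℝ)) z with hg
    have hg1 : EqOn g (fun z => Real.exp (-l * z) - 1 + l * z) (Ioc 0 1) := fun z hz => by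
      simp only [hg, indicator_of_mem hz, mul_one]
    have hg2 : EqOn g (fun z => Real.exp (-l * z) - 1) (Ioi 1) := fun z hz => by
      have : z ∉ Ioc (0 : ℝ) 1 := fun h => absurd h.2 (not_le.2 hz)
      simp only [hg, indicator_of_notMem this, mul_zero, add_zero]
    have hi1 : IntegrableOn g (Ioc 0 1) ν :=
      (integrableOn_congr_fun hg1 measurableSet_Ioc).2 (hsmall l hl)
    have hi2' : IntegrableOn (fun z => Real.exp (-l * z) - 1) (Ioi 1) ν := by
      refine Integrable.mono' hone (Continuous.aestronglyMeasurable (by fun_prop)) ?_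
      filter_upwards [ae_restrict_mem measurableSet_Ioi] with z hz
      have hz : 1 < z := hz
      have : Real.exp (-l * z) ≤ 1 := Real.exp_le_one_iff.2 (by nlinarith)
      rw [Real.norm_eq_abs, abs_le]
      constructor <;> linarith [Real.exp_pos (-l * z)]
    have hi2 : IntegrableOn g (Ioi 1) ν :=
      (integrableOn_congr_fun hg2 measurableSet_Ioi).2 hi2'
    have hsplit : ∫ z in Ioi (0 : ℝ), g z ∂ν = S l + ∫ z in Ioi (1 : ℝ), g z ∂ν := by
      rw [← Ioc_union_Ioi_eq_Ioi (zero_le_one' ℝ),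
        setIntegral_union (Ioc_disjoint_Ioi le_rfl) measurableSet_Ioi hi1 hi2,
        setIntegral_congr_fun measurableSet_Ioc hg1]
    have hlarge : -V ≤ ∫ z in Ioi (1 : ℝ), g z ∂ν := by
      rw [setIntegral_congr_fun measurableSet_Ioi hg2, hV, ← integral_neg]
      refine integral_mono hone.neg hi2' fun z => ?_
      linarith [Real.exp_pos (-l * z)]
    have : levyPsi γ σ ν l = γ * l + σ ^ 2 / 2 * l ^ 2 + ∫ z in Ioi (0 : ℝ), g z ∂ν := rfl
    linarith
  have hlin : ∃ ε > 0, ∀ᶠ l : ℝ in atTop,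
      ε * l ≤ (γ - β) * l + σ ^ 2 / 2 * l ^ 2 + S l := by
    by_cases hσ : 0 < σ
    · refine ⟨1, one_pos, ?_⟩
      filter_upwards [eventually_ge_atTop ((1 - (γ - β)) / (σ ^ 2 / 2)),
        eventually_ge_atTop 0] with l hl hl0
      rw [div_le_iff₀ (by positivity)] at hl
      nlinarith [hS0 l]
    · have hmass := h.resolve_left hσ
      obtain ⟨M, hβM, hM⟩ : ∃ M, β - γ < M ∧
          (smallJumpMass ν = ⊤ ∨ M < (smallJumpMass ν).toReal) := by
        rcases hmass with h | h
        · exact ⟨β - γ + 1, by linarith, Or.inl h⟩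
        · obtain ⟨M, h1, h2⟩ := exists_between (show β - γ < (smallJumpMass ν).toReal by linarith)
          exact ⟨M, h1, Or.inr h2⟩
      refine ⟨M - (β - γ), by linarith, ?_⟩
      filter_upwards [setIntegral_smallJumps_eventually_gt hsmall hM] with l hl
      nlinarith [mul_nonneg (sq_nonneg σ) (sq_nonneg l)]
  obtain ⟨ε, hε, hlin⟩ := hlin
  filter_upwards [hlin, eventually_ge_atTop 0, eventually_gt_atTop ((C + V) / ε)]
    with l hl hl0 hlC
  rw [div_lt_iff₀ hε] at hlC
  linarith [hbound l hl0]

theorem IsScaleFunction.eventually_laplace {f W : ℝ → ℝ} {Φ q : ℝ} (hW : IsScaleFunction f Φ q W)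
    (hf : ∀ᶠ l in atTop, q < f l) :
    ∀ᶠ l in atTop, IntegrableOn (fun y => Real.exp (-l * y) * W y) (Ioi 0) ∧
      ∫ y in Ioi (0 : ℝ), Real.exp (-l * y) * W y = 1 / (f l - q) := by
  filter_upwards [hf, eventually_gt_atTop Φ] with l hl hΦ
  have h := hW.2.2.2 l hΦ
  refine ⟨?_, h⟩
  by_contra hni
  rw [integral_undef hni] at h
  exact (one_div_pos.2 (sub_pos.2 hl)).ne h

/-- For all `p, q ≥ 0` and `x ≥ 0`,
`(q-p)∫₀ˣ 𝕎^{(p)}(x-y) W^{(q)}(y) dy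
  = W^{(q)}(x) - 𝕎^{(p)}(x) + α (W^{(q)}(0) 𝕎^{(p)}(x) + ∫₀ˣ 𝕎^{(p)}(x-y) W^{(q)′}(y) dy)`. -/
theorem scale_function_convolution
    (γ σ : ℝ) (hσ : 0 ≤ σ) (ν : Measure ℝ) (hν : IsLevyMeasure ν)
    (hnd : NonDegenerate γ σ ν)
    (α : ℝ) (hα : AlphaAdmissible γ σ α ν)
    (W W' Wα : ℝ → ℝ → ℝ)
    (hW : ∀ q, 0 ≤ q →
      IsScaleFunction (levyPsi γ σ ν) (levyPhi (levyPsi γ σ ν) q) q (W q))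
    (hW' : ∀ q, 0 ≤ q →
      (∀ y : ℝ, 0 < y → HasDerivAt (W q) (W' q y) y) ∧
        ContinuousOn (W' q) (Set.Ioi 0))
    (hWα : ∀ p, 0 ≤ p →
      IsScaleFunction (fun l => levyPsi γ σ ν l - α * l)
        (levyPhi (fun l => levyPsi γ σ ν l - α * l) p) p (Wα p)) :
    ∀ p, 0 ≤ p → ∀ q, 0 ≤ q → ∀ x : ℝ, 0 ≤ x →
      (q - p) * ∫ y in (0:ℝ)..x, Wα p (x - y) * W q y =
        W q x - Wα p x +
          α * (W q 0 * Wα p x + ∫ y in (0:ℝ)..x, Wα p (x - y) * W' q y) := by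
  intro p hp q hq x hx
  have hψ : ∀ᶠ l in atTop, q < levyPsi γ σ ν l := by
    simpa using levyPsi_sub_eventually_gt (β := 0) hν hnd q
  have hψα : ∀ᶠ l in atTop, p < levyPsi γ σ ν l - α * l := by
    refine levyPsi_sub_eventually_gt hν ?_ p
    by_cases h1 : 0 < σ
    · exact Or.inl h1
    by_cases h2 : smallJumpMass ν = ⊤
    · exact Or.inr (Or.inl h2)
    exact Or.inr (Or.inr (hα.2 ⟨le_antisymm (not_lt.1 h1) hσ, h2⟩))
  have hlapW := (hW q hq).eventually_laplace hψ
  have hlapA := (hWα p hp).eventually_laplace hψα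
  obtain ⟨-, hWc, hWm, -⟩ := hW q hq
  obtain ⟨hA0, hAc, -, -⟩ := hWα p hp
  have hWd := (hW' q hq).1
  set C₁ : ℝ → ℝ := fun x => ∫ y in (0 : ℝ)..x, Wα p (x - y) * W q y with hC₁
  set C₂ : ℝ → ℝ := fun x => ∫ y in (0 : ℝ)..x, Wα p (x - y) * W' q y with hC₂
  set F : ℝ → ℝ := fun x => (q - p) * C₁ x -
    (W q x - Wα p x + α * (W q 0 * Wα p x + C₂ x)) with hF
  have hlapF : ∀ᶠ l in atTop, IntegrableOn (fun y => Real.exp (-l * y) * W' q y) (Ioi 0) ∧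
      IntegrableOn (fun y => Real.exp (-l * y) * F y) (Ioi 0) ∧
      ∫ y in Ioi (0 : ℝ), Real.exp (-l * y) * F y = 0 := by
    filter_upwards [hψ, hψα, hlapW, hlapA, eventually_gt_atTop 0]
      with l hl hlα ⟨hWi, hWl⟩ ⟨hAi, hAl⟩ hl0
    obtain ⟨hdi, hdl⟩ := laplace_deriv hl0 hWc hWm hWd hWi
    obtain ⟨h1i, h1l⟩ := laplace_convolution hAi hWi
    obtain ⟨h2i, h2l⟩ := laplace_convolution hAi hdi
    have hexpand : (fun y => Real.exp (-l * y) * F y) = fun y =>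
        (q - p) * (Real.exp (-l * y) * C₁ y) - (Real.exp (-l * y) * W q y -
          Real.exp (-l * y) * Wα p y + (α * W q 0 * (Real.exp (-l * y) * Wα p y) +
            α * (Real.exp (-l * y) * C₂ y))) := by
      ext y
      simp only [hF]
      ring
    have hi₁ : IntegrableOn (fun y => (q - p) * (Real.exp (-l * y) * C₁ y)) (Ioi 0) :=
      h1i.const_mul (q - p)
    have hi₂ : IntegrableOn (fun y => Real.exp (-l * y) * W q y -
        Real.exp (-l * y) * Wα p y) (Ioi 0) := hWi.sub hAi
    have hi₃ : IntegrableOn (fun y => α * W q 0 * (Real.exp (-l * y) * Wα p y)) (Ioi 0) :=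
      hAi.const_mul (α * W q 0)
    have hi₄ : IntegrableOn (fun y => α * (Real.exp (-l * y) * C₂ y)) (Ioi 0) :=
      h2i.const_mul α
    have hi₅ : IntegrableOn (fun y => α * W q 0 * (Real.exp (-l * y) * Wα p y) +
        α * (Real.exp (-l * y) * C₂ y)) (Ioi 0) := hi₃.add hi₄
    have hi₆ : IntegrableOn (fun y => Real.exp (-l * y) * W q y -
        Real.exp (-l * y) * Wα p y + (α * W q 0 * (Real.exp (-l * y) * Wα p y) +
          α * (Real.exp (-l * y) * C₂ y))) (Ioi 0) := hi₂.add hi₅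
    refine ⟨hdi, ?_, ?_⟩
    · rw [hexpand]
      exact hi₁.sub hi₆
    · rw [hexpand, integral_sub hi₁ hi₆, integral_add hi₂ hi₅,
        integral_sub hWi hAi, integral_add hi₃ hi₄, integral_const_mul, integral_const_mul,
        integral_const_mul, h1l, h2l, hdl, hWl, hAl]
      have hne : levyPsi γ σ ν l - q ≠ 0 := (sub_pos.2 hl).ne'
      have hneα : levyPsi γ σ ν l - α * l - p ≠ 0 := (sub_pos.2 hlα).ne'
      field_simp
      ring
  obtain ⟨l₀, hl₀⟩ := eventually_atTop.1 hlapF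
  have hW'i : ∀ R, IntegrableOn (W' q) (Ioc 0 R) := by
    intro R
    rcases le_or_gt R 0 with hR | hR
    · simp [Ioc_eq_empty (not_lt.2 hR)]
    have hc : ContinuousOn (W q) (Icc 0 R) := hWc.mono Icc_subset_Ici_self
    refine intervalIntegral.integrableOn_deriv_of_nonneg hc (fun y hy => hWd y hy.1)
      fun y hy => ?_
    rw [← (hWd y hy.1).hasDerivWithinAt.derivWithin
      (uniqueDiffOn_Ici (0 : ℝ) y hy.1.le)]
    exact hWm.derivWithin_nonneg
  have hWi : ∀ R, IntegrableOn (W q) (Ioc 0 R) := fun R =>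
    ((hWc.mono Icc_subset_Ici_self).integrableOn_Icc).mono_set Ioc_subset_Icc_self
  have hFc : ContinuousOn F (Ici 0) :=
    (continuousOn_const.mul (continuousOn_convolution hA0 hAc hWi)).sub
      ((hWc.sub hAc).add (continuousOn_const.mul ((continuousOn_const.mul hAc).add
        (continuousOn_convolution hA0 hAc hW'i))))
  have hzero := eqOn_zero_of_laplace_eq_zero hFc (hl₀ l₀ le_rfl).2.1
    (fun n => (hl₀ (l₀ + n) (by simp)).2.2) hx
  exact sub_eq_zero.1 hzero
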